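/- Let w : ℝ² → ℝ be a polynomial function of degree at most 3 and fix any j ∈ {1, 2, 3}. Then there exists a polynomial p₂ of degree at most 2 such that w = Σ_{i=1}^{4} c_i φ_M^i + p₂, where c_k = −(|e_k|³/6) · D³w[t_k, t_k, t_k] for k = 1, 2, 3 and c₄ = (|e_{j+1}| |e_{j−1}|²/2) · D³w[t_{j−1}, t_{j−1}, t_{j+1}] − (|e_{j+1}|³/6) · D³w[t_{j+1}, t_{j+1}, t_{j+1}] + (|e_{j−1}|³/6) · D³w[t_{j−1}, t_{j−1}, t_{j−1}]. -/

import Mathlib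

noncomputable section
open MeasureTheory

namespace PaperStmt

/-- Euclidean dot product on `ℝ²`. -/
def dotp (v w : ℝ × ℝ) : ℝ := v.1 * w.1 + v.2 * w.2

/-- Euclidean length on `ℝ²`. -/
def len (v : ℝ × ℝ) : ℝ := Real.sqrt (v.1 ^ 2 + v.2 ^ 2)

/-- Cross product (determinant) of two planar vectors. -/
def crossp (v w : ℝ × ℝ) : ℝ := v.1 * w.2 - v.2 * w.1

/-- The vertices `p 0, p 1, p 2` form a nondegenerate triangle listed counterclockwise. -/
def Ccw (p : Fin 3 → ℝ × ℝ) : Prop := 0 < crossp (p 1 - p 0) (p 2 - p 0)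

/-- Vector of the edge `e_i` opposite vertex `p i`, oriented counterclockwise
(from `p (i+1)` to `p (i−1)`). -/
def edgeVec (p : Fin 3 → ℝ × ℝ) (i : Fin 3) : ℝ × ℝ := p (i - 1) - p (i + 1)

/-- Length `|e_i|` of the edge opposite vertex `p i`. -/
def elen (p : Fin 3 → ℝ × ℝ) (i : Fin 3) : ℝ := len (edgeVec p i)

/-- Unit tangent `t_i = (p_{i−1} − p_{i+1})/|e_i|` of edge `e_i`. -/
def tvec (p : Fin 3 → ℝ × ℝ) (i : Fin 3) : ℝ × ℝ := (elen p i)⁻¹ • edgeVec p i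

/-- Outward unit normal `n_i` of edge `e_i` (clockwise rotation of the tangent,
which points outward for a counterclockwise triangle). -/
def nvec (p : Fin 3 → ℝ × ℝ) (i : Fin 3) : ℝ × ℝ := ((tvec p i).2, -(tvec p i).1)

/-- Interior angle `θ_i` of the triangle at the vertex `p i`. -/
def angleAt (p : Fin 3 → ℝ × ℝ) (i : Fin 3) : ℝ :=
  Real.arccos (dotp (p (i + 1) - p i) (p (i - 1) - p i) /
    (len (p (i + 1) - p i) * len (p (i - 1) - p i)))

/-- Outer product `v wᵀ` of two planar (column) vectors, as a `2 × 2` matrix. -/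
def outerProd (v w : ℝ × ℝ) : Matrix (Fin 2) (Fin 2) ℝ :=
  !![v.1 * w.1, v.1 * w.2; v.2 * w.1, v.2 * w.2]

/-- Basis matrices `φ_HHJ^i = −(1/(2 sin θ_{i−1} sin θ_{i+1})) (t_{i−1} t_{i+1}ᵀ + t_{i+1} t_{i−1}ᵀ)`
of the lowest-order Hellan–Herrmann–Johnson element. -/
def phiHHJ (p : Fin 3 → ℝ × ℝ) (i : Fin 3) : Matrix (Fin 2) (Fin 2) ℝ :=
  (-(2 * Real.sin (angleAt p (i - 1)) * Real.sin (angleAt p (i + 1)))⁻¹) •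
    (outerProd (tvec p (i - 1)) (tvec p (i + 1)) + outerProd (tvec p (i + 1)) (tvec p (i - 1)))

/-- The quadratic form `vᵀ τ v` of a `2 × 2` matrix on a planar vector. -/
def qf (τ : Matrix (Fin 2) (Fin 2) ℝ) (v : ℝ × ℝ) : ℝ :=
  v.1 * (τ 0 0 * v.1 + τ 0 1 * v.2) + v.2 * (τ 1 0 * v.1 + τ 1 1 * v.2)

end PaperStmt

namespace PaperStmt

/-- Directional derivative of `f` along `v`. -/
def dderiv (v : ℝ × ℝ) (f : ℝ × ℝ → ℝ) : ℝ × ℝ → ℝ := fun x => fderiv ℝ f x v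

/-- Second directional derivative `D²f[u, v]`. -/
def d2 (u v : ℝ × ℝ) (f : ℝ × ℝ → ℝ) : ℝ × ℝ → ℝ := dderiv u (dderiv v f)

/-- Third directional derivative `D³f[u, v, w]`. -/
def d3 (u v w : ℝ × ℝ) (f : ℝ × ℝ → ℝ) : ℝ × ℝ → ℝ := dderiv u (dderiv v (dderiv w f))

/-- `ψ` is the family of barycentric coordinates of the triangle with vertices `p`:
affine functions with `ψ i (p j) = δ_{ij}`. -/
def IsBarycentric (p : Fin 3 → ℝ × ℝ) (ψ : Fin 3 → ℝ × ℝ → ℝ) : Prop :=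
  (∀ i : Fin 3, ∃ a b c : ℝ, ∀ x : ℝ × ℝ, ψ i x = a * x.1 + b * x.2 + c) ∧
  (∀ i j : Fin 3, ψ i (p j) = if i = j then 1 else 0)

/-- Morley bubble `φ_M^i = ψ_{i−1}² ψ_{i+1}` for `i = 1, 2, 3`. -/
def phiM3 (ψ : Fin 3 → ℝ × ℝ → ℝ) (i : Fin 3) : ℝ × ℝ → ℝ :=
  fun x => (ψ (i - 1) x) ^ 2 * ψ (i + 1) x

/-- Morley bubble `φ_M^4 = ψ₁ ψ₂ ψ₃`. -/
def phiM4 (ψ : Fin 3 → ℝ × ℝ → ℝ) : ℝ × ℝ → ℝ :=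
  fun x => ψ 0 x * ψ 1 x * ψ 2 x

/-- The four Morley bubbles `φ_M^1, φ_M^2, φ_M^3, φ_M^4`. -/
def phiM (ψ : Fin 3 → ℝ × ℝ → ℝ) : Fin 4 → ℝ × ℝ → ℝ :=
  ![phiM3 ψ 0, phiM3 ψ 1, phiM3 ψ 2, phiM4 ψ]

end PaperStmt

namespace PaperStmt

/-- `f : ℝ² → ℝ` is a polynomial function of (total) degree at most `l`. -/
def IsPolyFun (l : ℕ) (f : ℝ × ℝ → ℝ) : Prop :=
  ∃ q : MvPolynomial (Fin 2) ℝ, q.totalDegree ≤ l ∧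
    ∀ x : ℝ × ℝ, f x = MvPolynomial.eval ![x.1, x.2] q

end PaperStmt

namespace PaperStmt

/-- Explicit cubic polynomial function. -/
def cub (a b c d e f g h k l : ℝ) (x : ℝ × ℝ) : ℝ :=
  a * x.1 ^ 3 + b * (x.1 ^ 2 * x.2) + c * (x.1 * x.2 ^ 2) + d * x.2 ^ 3 +
    e * x.1 ^ 2 + f * (x.1 * x.2) + g * x.2 ^ 2 + h * x.1 + k * x.2 + l

theorem dderiv_cub (a b c d e f g h k l : ℝ) (v : ℝ × ℝ) :
    dderiv v (cub a b c d e f g h k l) =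
      cub 0 0 0 0 (3 * a * v.1 + b * v.2) (2 * b * v.1 + 2 * c * v.2) (c * v.1 + 3 * d * v.2)
        (2 * e * v.1 + f * v.2) (f * v.1 + 2 * g * v.2) (h * v.1 + k * v.2) := by
  funext x
  have h1 : HasFDerivAt (fun x : ℝ × ℝ => x.1) (ContinuousLinearMap.fst ℝ ℝ ℝ) x := hasFDerivAt_fst
  have h2 : HasFDerivAt (fun x : ℝ × ℝ => x.2) (ContinuousLinearMap.snd ℝ ℝ ℝ) x := hasFDerivAt_snd
  have H := ((((((((((h1.pow 3).const_mul a).add (((h1.pow 2).mul h2).const_mul b)).add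
    ((h1.mul (h2.pow 2)).const_mul c)).add ((h2.pow 3).const_mul d)).add
    ((h1.pow 2).const_mul e)).add ((h1.mul h2).const_mul f)).add ((h2.pow 2).const_mul g)).add
    (h1.const_mul h)).add (h2.const_mul k)).add_const l
  have H₁ := H.fderiv
  have e1 : dderiv v (cub a b c d e f g h k l) x = _ := congrArg (fun L => L v) H₁
  rw [e1]
  simp [cub]
  ring

theorem d3_cub (a b c d e f g h k l : ℝ) (u v s : ℝ × ℝ) :
    d3 u v s (cub a b c d e f g h k l) 0 =
      6 * a * (u.1 * v.1 * s.1) + 2 * b * (u.1 * v.1 * s.2 + u.1 * v.2 * s.1 + u.2 * v.1 * s.1) +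
      2 * c * (u.1 * v.2 * s.2 + u.2 * v.1 * s.2 + u.2 * v.2 * s.1) +
      6 * d * (u.2 * v.2 * s.2) := by
  unfold d3
  rw [dderiv_cub, dderiv_cub, dderiv_cub]
  simp [cub]
  ring

theorem exists_cub_of_isPolyFun (w : ℝ × ℝ → ℝ) (hw : IsPolyFun 3 w) :
    ∃ a b c d e f g h k l : ℝ, w = cub a b c d e f g h k l := by
  obtain ⟨q, hq, hw⟩ := hw
  have hw₁ : w = fun x : ℝ × ℝ => ∑ m ∈ q.support, q.coeff m * (x.1 ^ m 0 * x.2 ^ m 1) := by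
    funext x
    rw [hw, MvPolynomial.eval_eq']
    simp [Fin.prod_univ_two]
  have hdeg : ∀ m ∈ q.support, m 0 + m 1 ≤ 3 := by
    intro m hm
    have := (MvPolynomial.le_totalDegree hm).trans hq
    rwa [Finsupp.sum_fintype _ _ (fun _ => rfl), Fin.sum_univ_two] at this
  rw [hw₁]
  clear hw₁ hw hq
  revert hdeg
  generalize q.support = T
  intro hdeg
  induction T using Finset.induction_on with
  | empty => exact ⟨0, 0, 0, 0, 0, 0, 0, 0, 0, 0, by funext x; simp [cub]⟩
  | insert m S hm ih =>
    obtain ⟨a, b, c, d, e, f, g, h, k, l, H⟩ := ih (fun n hn => hdeg n (Finset.mem_insert_of_mem hn))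
    have hm₁ := hdeg m (Finset.mem_insert_self _ _)
    have key : ∃ a b c d e f g h k l : ℝ, ∀ x : ℝ × ℝ,
        q.coeff m * (x.1 ^ m 0 * x.2 ^ m 1) = cub a b c d e f g h k l x := by
      generalize q.coeff m = z
      generalize m 0 = r at *
      generalize m 1 = t at *
      have hr : r ≤ 3 := by omega
      have ht : t ≤ 3 := by omega
      refine ⟨if r = 3 ∧ t = 0 then z else 0, if r = 2 ∧ t = 1 then z else 0,
        if r = 1 ∧ t = 2 then z else 0, if r = 0 ∧ t = 3 then z else 0,
        if r = 2 ∧ t = 0 then z else 0, if r = 1 ∧ t = 1 then z else 0,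
        if r = 0 ∧ t = 2 then z else 0, if r = 1 ∧ t = 0 then z else 0,
        if r = 0 ∧ t = 1 then z else 0, if r = 0 ∧ t = 0 then z else 0, ?_⟩
      intro x
      interval_cases r <;> interval_cases t <;> first | omega | simp [cub]
    obtain ⟨a₁, b₁, c₁, d₁, e₁, f₁, g₁, h₁, k₁, l₁, H₁⟩ := key
    refine ⟨a₁ + a, b₁ + b, c₁ + c, d₁ + d, e₁ + e, f₁ + f, g₁ + g, h₁ + h, k₁ + k, l₁ + l, ?_⟩
    funext x
    rw [Finset.sum_insert hm, H₁, congrFun H x]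
    simp only [cub]
    ring

theorem isPolyFun_quad (e f g h k l : ℝ) : IsPolyFun 2 (cub 0 0 0 0 e f g h k l) := by
  let X := (MvPolynomial.X 0 : MvPolynomial (Fin 2) ℝ)
  let Y := (MvPolynomial.X 1 : MvPolynomial (Fin 2) ℝ)
  let C := fun r : ℝ => (MvPolynomial.C r : MvPolynomial (Fin 2) ℝ)
  refine ⟨C e * (X * X) + C f * (X * Y) + C g * (Y * Y) + C h * X + C k * Y + C l, ?_, ?_⟩
  · have hX : X.totalDegree ≤ 1 := (MvPolynomial.totalDegree_X _).le
    have hY : Y.totalDegree ≤ 1 := (MvPolynomial.totalDegree_X _).le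
    have hC : ∀ r, (C r).totalDegree ≤ 0 := fun r => (MvPolynomial.totalDegree_C r).le
    have hAdd : ∀ P Q : MvPolynomial (Fin 2) ℝ, P.totalDegree ≤ 2 → Q.totalDegree ≤ 2 →
        (P + Q).totalDegree ≤ 2 := fun P Q hP hQ =>
      (MvPolynomial.totalDegree_add P Q).trans (max_le hP hQ)
    have hMul : ∀ (m n s : ℕ) (P Q : MvPolynomial (Fin 2) ℝ), P.totalDegree ≤ m →
        Q.totalDegree ≤ n → m + n ≤ s → (P * Q).totalDegree ≤ s := fun m n s P Q hP hQ hs =>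
      (MvPolynomial.totalDegree_mul P Q).trans (by omega)
    have hXX := hMul 1 1 2 X X hX hX (by norm_num)
    have hXY := hMul 1 1 2 X Y hX hY (by norm_num)
    have hYY := hMul 1 1 2 Y Y hY hY (by norm_num)
    refine hAdd _ _ (hAdd _ _ (hAdd _ _ (hAdd _ _ (hAdd _ _ ?_ ?_) ?_) ?_) ?_) ?_
    · exact hMul 0 2 2 _ _ (hC _) hXX (by norm_num)
    · exact hMul 0 2 2 _ _ (hC _) hXY (by norm_num)
    · exact hMul 0 2 2 _ _ (hC _) hYY (by norm_num)
    · exact hMul 0 1 2 _ _ (hC _) hX (by norm_num)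
    · exact hMul 0 1 2 _ _ (hC _) hY (by norm_num)
    · exact (hC _).trans (by norm_num)
  · intro x
    simp [cub, X, Y, C]
    ring

/-- Quadratic function with explicit coefficients, up to existence. -/
def IsQuad (q : ℝ × ℝ → ℝ) : Prop :=
  ∃ e f g h k l : ℝ, ∀ x, q x = cub 0 0 0 0 e f g h k l x

theorem IsQuad.isPolyFun {q : ℝ × ℝ → ℝ} (hq : IsQuad q) : IsPolyFun 2 q := by
  obtain ⟨e, f, g, h, k, l, H⟩ := hq
  rw [show q = _ from funext H]
  exact isPolyFun_quad e f g h k l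

theorem IsQuad.sub_smul {q r : ℝ × ℝ → ℝ} (hq : IsQuad q) (hr : IsQuad r) (z : ℝ) :
    IsQuad (fun x => q x - z * r x) := by
  obtain ⟨e, f, g, h, k, l, H⟩ := hq
  obtain ⟨e₁, f₁, g₁, h₁, k₁, l₁, H₁⟩ := hr
  refine ⟨e - z * e₁, f - z * f₁, g - z * g₁, h - z * h₁, k - z * k₁, l - z * l₁, fun x => ?_⟩
  simp only [H, H₁, cub]
  ring

theorem isQuad_prod (a b c a₁ b₁ c₁ a₂ b₂ c₂ : ℝ) :
    IsQuad (fun x => (a * x.1 + b * x.2 + c) * (a₁ * x.1 + b₁ * x.2 + c₁) *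
      (a₂ * x.1 + b₂ * x.2 + c₂) -
      (a * x.1 + b * x.2) * (a₁ * x.1 + b₁ * x.2) * (a₂ * x.1 + b₂ * x.2)) := by
  refine ⟨c₂ * a * a₁ + c₁ * a * a₂ + c * a₁ * a₂,
    c₂ * (a * b₁ + b * a₁) + c₁ * (a * b₂ + b * a₂) + c * (a₁ * b₂ + b₁ * a₂),
    c₂ * b * b₁ + c₁ * b * b₂ + c * b₁ * b₂,
    c * c₁ * a₂ + c * c₂ * a₁ + c₁ * c₂ * a,
    c * c₁ * b₂ + c * c₂ * b₁ + c₁ * c₂ * b, c * c₁ * c₂, fun x => ?_⟩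
  simp only [cub]
  ring

/-- An affine function vanishing at the three vertices has zero coefficients. -/
theorem affine_zero (p : Fin 3 → ℝ × ℝ) (hp : Ccw p) (a b c : ℝ)
    (h : ∀ i, a * (p i).1 + b * (p i).2 + c = 0) : a = 0 ∧ b = 0 ∧ c = 0 := by
  have h0 := h 0
  have h1 := h 1
  have h2 := h 2
  unfold Ccw crossp at hp
  simp only [Prod.fst_sub, Prod.snd_sub] at hp
  have ha : a = 0 := by
    refine (mul_eq_zero.1 (?_ : _ * a = 0)).resolve_left hp.ne'
    linear_combination ((p 2).2 - (p 0).2) * (h1 - h0) - ((p 1).2 - (p 0).2) * (h2 - h0)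
  have hb : b = 0 := by
    refine (mul_eq_zero.1 (?_ : _ * b = 0)).resolve_left hp.ne'
    linear_combination ((p 1).1 - (p 0).1) * (h2 - h0) - ((p 2).1 - (p 0).1) * (h1 - h0)
  refine ⟨ha, hb, ?_⟩
  subst ha hb
  linarith

theorem elen_ne_zero (p : Fin 3 → ℝ × ℝ) (hp : Ccw p) (i : Fin 3) : elen p i ≠ 0 := by
  intro h0
  unfold elen len at h0
  rw [Real.sqrt_eq_zero (by positivity)] at h0
  have h1 : (edgeVec p i).1 = 0 := by nlinarith [sq_nonneg (edgeVec p i).1, sq_nonneg (edgeVec p i).2]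
  have h2 : (edgeVec p i).2 = 0 := by nlinarith [sq_nonneg (edgeVec p i).1, sq_nonneg (edgeVec p i).2]
  unfold Ccw crossp at hp
  simp only [Prod.fst_sub, Prod.snd_sub] at hp
  simp only [edgeVec, Prod.fst_sub, Prod.snd_sub] at h1 h2
  apply hp.ne'
  fin_cases i
  · change (p 2).1 - (p 1).1 = 0 at h1
    change (p 2).2 - (p 1).2 = 0 at h2
    linear_combination ((p 1).1 - (p 0).1) * h2 - ((p 1).2 - (p 0).2) * h1
  · change (p 0).1 - (p 2).1 = 0 at h1
    change (p 0).2 - (p 2).2 = 0 at h2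
    linear_combination -((p 1).1 - (p 0).1) * h2 + ((p 1).2 - (p 0).2) * h1
  · change (p 1).1 - (p 0).1 = 0 at h1
    change (p 1).2 - (p 0).2 = 0 at h2
    linear_combination ((p 2).2 - (p 0).2) * h1 - ((p 2).1 - (p 0).1) * h2

theorem edge_eq (p : Fin 3 → ℝ × ℝ) (hp : Ccw p) (i : Fin 3) :
    edgeVec p i = elen p i • tvec p i := by
  unfold tvec
  rw [smul_smul, mul_inv_cancel₀ (elen_ne_zero p hp i), one_smul]

/-- Scaling the third derivative from unit tangents to edge vectors. -/
theorem d3_scale (a b c d e f g h k l r s t : ℝ) (u v z : ℝ × ℝ) :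
    d3 (r • u) (s • v) (t • z) (cub a b c d e f g h k l) 0 =
      r * s * t * d3 u v z (cub a b c d e f g h k l) 0 := by
  rw [d3_cub, d3_cub]
  simp only [Prod.smul_fst, Prod.smul_snd, smul_eq_mul]
  ring

end PaperStmt

open PaperStmt in
/-- Every polynomial `w` of degree ≤ 3 decomposes as `w = Σ_{i=1}^4 c_i φ_M^i + p₂` with
`p₂` of degree ≤ 2, where `c_k = −(|e_k|³/6) D³w[t_k,t_k,t_k]` for `k = 1,2,3` and
`c₄ = (|e_{j+1}||e_{j−1}|²/2) D³w[t_{j−1},t_{j−1},t_{j+1}] − (|e_{j+1}|³/6) D³w[t_{j+1},t_{j+1},t_{j+1}]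
      + (|e_{j−1}|³/6) D³w[t_{j−1},t_{j−1},t_{j−1}]`. -/
theorem cubic_morley_bubble_decomposition
    (p : Fin 3 → ℝ × ℝ) (hp : Ccw p)
    (ψ : Fin 3 → ℝ × ℝ → ℝ) (hψ : IsBarycentric p ψ)
    (w : ℝ × ℝ → ℝ) (hw : IsPolyFun 3 w) (j : Fin 3) :
    ∃ p₂ : ℝ × ℝ → ℝ, IsPolyFun 2 p₂ ∧
      ∀ x : ℝ × ℝ,
        w x =
          (∑ k : Fin 3,
            (-(elen p k ^ 3 / 6) * d3 (tvec p k) (tvec p k) (tvec p k) w 0) * phiM3 ψ k x) +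
          (elen p (j + 1) * elen p (j - 1) ^ 2 / 2 *
              d3 (tvec p (j - 1)) (tvec p (j - 1)) (tvec p (j + 1)) w 0 -
            elen p (j + 1) ^ 3 / 6 *
              d3 (tvec p (j + 1)) (tvec p (j + 1)) (tvec p (j + 1)) w 0 +
            elen p (j - 1) ^ 3 / 6 *
              d3 (tvec p (j - 1)) (tvec p (j - 1)) (tvec p (j - 1)) w 0) * phiM4 ψ x +
          p₂ x := by
  obtain ⟨a, b, c, d, e, f, g, h, k, l, rfl⟩ := exists_cub_of_isPolyFun w hw
  obtain ⟨haff, hdel⟩ := hψ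
  choose A B C hABC using haff
  -- linear relations
  have hδ : ∀ i j : Fin 3, A i * (p j).1 + B i * (p j).2 + C i = if i = j then 1 else 0 :=
    fun i j => (hABC i (p j)).symm.trans (hdel i j)
  have hsum := affine_zero p hp (A 0 + A 1 + A 2) (B 0 + B 1 + B 2) (C 0 + C 1 + C 2 - 1) (by
    intro i
    have e0 := hδ 0 i
    have e1 := hδ 1 i
    have e2 := hδ 2 i
    fin_cases i <;> simp at e0 e1 e2 ⊢ <;> linarith)
  have hx1 := affine_zero p hp (A 0 * (p 0).1 + A 1 * (p 1).1 + A 2 * (p 2).1 - 1)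
    (B 0 * (p 0).1 + B 1 * (p 1).1 + B 2 * (p 2).1)
    (C 0 * (p 0).1 + C 1 * (p 1).1 + C 2 * (p 2).1) (by
    intro i
    have e0 := hδ 0 i
    have e1 := hδ 1 i
    have e2 := hδ 2 i
    fin_cases i <;> simp at e0 e1 e2 ⊢ <;>
      linear_combination (p 0).1 * e0 + (p 1).1 * e1 + (p 2).1 * e2)
  have hx2 := affine_zero p hp (A 0 * (p 0).2 + A 1 * (p 1).2 + A 2 * (p 2).2)
    (B 0 * (p 0).2 + B 1 * (p 1).2 + B 2 * (p 2).2 - 1)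
    (C 0 * (p 0).2 + C 1 * (p 1).2 + C 2 * (p 2).2) (by
    intro i
    have e0 := hδ 0 i
    have e1 := hδ 1 i
    have e2 := hδ 2 i
    fin_cases i <;> simp at e0 e1 e2 ⊢ <;>
      linear_combination (p 0).2 * e0 + (p 1).2 * e1 + (p 2).2 * e2)
  obtain ⟨s1, s2, -⟩ := hsum
  obtain ⟨u1, u2, -⟩ := hx1
  obtain ⟨v1, v2, -⟩ := hx2
  -- coefficients in terms of edge vectors
  have hck : ∀ i, -(elen p i ^ 3 / 6) *
      d3 (tvec p i) (tvec p i) (tvec p i) (cub a b c d e f g h k l) 0 =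
      -(1 / 6) * d3 (edgeVec p i) (edgeVec p i) (edgeVec p i) (cub a b c d e f g h k l) 0 := by
    intro i
    rw [edge_eq p hp i, d3_scale]
    ring
  have hc4 : elen p (j + 1) * elen p (j - 1) ^ 2 / 2 *
      d3 (tvec p (j - 1)) (tvec p (j - 1)) (tvec p (j + 1)) (cub a b c d e f g h k l) 0 -
      elen p (j + 1) ^ 3 / 6 *
      d3 (tvec p (j + 1)) (tvec p (j + 1)) (tvec p (j + 1)) (cub a b c d e f g h k l) 0 +
      elen p (j - 1) ^ 3 / 6 *
      d3 (tvec p (j - 1)) (tvec p (j - 1)) (tvec p (j - 1)) (cub a b c d e f g h k l) 0 =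
      1 / 2 * d3 (edgeVec p (j - 1)) (edgeVec p (j - 1)) (edgeVec p (j + 1))
        (cub a b c d e f g h k l) 0 -
      1 / 6 * d3 (edgeVec p (j + 1)) (edgeVec p (j + 1)) (edgeVec p (j + 1))
        (cub a b c d e f g h k l) 0 +
      1 / 6 * d3 (edgeVec p (j - 1)) (edgeVec p (j - 1)) (edgeVec p (j - 1))
        (cub a b c d e f g h k l) 0 := by
    rw [edge_eq p hp (j - 1), edge_eq p hp (j + 1)]
    simp only [d3_scale]
    ring
  simp only [hck, hc4]
  set c4 := 1 / 2 * d3 (edgeVec p (j - 1)) (edgeVec p (j - 1)) (edgeVec p (j + 1))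
        (cub a b c d e f g h k l) 0 -
      1 / 6 * d3 (edgeVec p (j + 1)) (edgeVec p (j + 1)) (edgeVec p (j + 1))
        (cub a b c d e f g h k l) 0 +
      1 / 6 * d3 (edgeVec p (j - 1)) (edgeVec p (j - 1)) (edgeVec p (j - 1))
        (cub a b c d e f g h k l) 0 with hc4def
  set cc : Fin 3 → ℝ := fun i =>
    -(1 / 6) * d3 (edgeVec p i) (edgeVec p i) (edgeVec p i) (cub a b c d e f g h k l) 0 with hcc
  have hphi : ∀ i, IsQuad (fun x => phiM3 ψ i x -
      (A (i - 1) * x.1 + B (i - 1) * x.2) ^ 2 * (A (i + 1) * x.1 + B (i + 1) * x.2)) := by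
    intro i
    have := isQuad_prod (A (i - 1)) (B (i - 1)) (C (i - 1)) (A (i - 1)) (B (i - 1)) (C (i - 1))
      (A (i + 1)) (B (i + 1)) (C (i + 1))
    convert this using 2 with x
    simp only [phiM3, hABC]
    ring
  have hphi4 : IsQuad (fun x => phiM4 ψ x -
      (A 0 * x.1 + B 0 * x.2) * (A 1 * x.1 + B 1 * x.2) * (A 2 * x.1 + B 2 * x.2)) := by
    have := isQuad_prod (A 0) (B 0) (C 0) (A 1) (B 1) (C 1) (A 2) (B 2) (C 2)
    convert this using 2 with x
    simp only [phiM4, hABC]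
  have hlow : IsQuad (cub 0 0 0 0 e f g h k l) := ⟨e, f, g, h, k, l, fun _ => rfl⟩
  have hQ := (((hlow.sub_smul (hphi 0) (cc 0)).sub_smul (hphi 1) (cc 1)).sub_smul
    (hphi 2) (cc 2)).sub_smul hphi4 c4
  refine ⟨_, hQ.isPolyFun, fun x => ?_⟩
  -- the homogeneous cubic identity
  have main : a * x.1 ^ 3 + b * (x.1 ^ 2 * x.2) + c * (x.1 * x.2 ^ 2) + d * x.2 ^ 3 =
      cc 0 * ((A 2 * x.1 + B 2 * x.2) ^ 2 * (A 1 * x.1 + B 1 * x.2)) +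
      cc 1 * ((A 0 * x.1 + B 0 * x.2) ^ 2 * (A 2 * x.1 + B 2 * x.2)) +
      cc 2 * ((A 1 * x.1 + B 1 * x.2) ^ 2 * (A 0 * x.1 + B 0 * x.2)) +
      c4 * ((A 0 * x.1 + B 0 * x.2) * (A 1 * x.1 + B 1 * x.2) * (A 2 * x.1 + B 2 * x.2)) := by
    have E0 : edgeVec p 0 = p 2 - p 1 := rfl
    have E1 : edgeVec p 1 = p 0 - p 2 := rfl
    have E2 : edgeVec p 2 = p 1 - p 0 := rfl
    have X1 : x.1 = (A 0 * x.1 + B 0 * x.2) * (p 0).1 + (A 1 * x.1 + B 1 * x.2) * (p 1).1 +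
        (A 2 * x.1 + B 2 * x.2) * (p 2).1 := by
      linear_combination -x.1 * u1 - x.2 * u2
    have X2 : x.2 = (A 0 * x.1 + B 0 * x.2) * (p 0).2 + (A 1 * x.1 + B 1 * x.2) * (p 1).2 +
        (A 2 * x.1 + B 2 * x.2) * (p 2).2 := by
      linear_combination -x.1 * v1 - x.2 * v2
    have L : A 0 * x.1 + B 0 * x.2 = -(A 1 * x.1 + B 1 * x.2) - (A 2 * x.1 + B 2 * x.2) := by
      linear_combination x.1 * s1 + x.2 * s2
    generalize A 0 * x.1 + B 0 * x.2 = l0 at *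
    generalize A 1 * x.1 + B 1 * x.2 = l1 at *
    generalize A 2 * x.1 + B 2 * x.2 = l2 at *
    rw [X1, X2, L, hc4def]
    simp only [hcc]
    have J : (j - 1 = 2 ∧ j + 1 = 1) ∨ (j - 1 = 0 ∧ j + 1 = 2) ∨ (j - 1 = 1 ∧ j + 1 = 0) := by
      clear * -
      revert j
      decide
    rcases J with ⟨J1, J2⟩ | ⟨J1, J2⟩ | ⟨J1, J2⟩ <;> rw [J1, J2] <;>
      simp only [E0, E1, E2, d3_cub, Prod.fst_sub, Prod.snd_sub] <;> ring
  have i0 : (0 : Fin 3) - 1 = 2 := rfl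
  have i1 : (1 : Fin 3) - 1 = 0 := rfl
  have i2 : (2 : Fin 3) - 1 = 1 := rfl
  have k0 : (0 : Fin 3) + 1 = 1 := rfl
  have k1 : (1 : Fin 3) + 1 = 2 := rfl
  have k2 : (2 : Fin 3) + 1 = 0 := rfl
  simp only [Fin.sum_univ_three, i0, i1, i2, k0, k1, k2]
  simp only [cub] at main ⊢
  linear_combination main
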